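/- Let K be an infinite field, let p be a positive integer, and let R be a p×p reflexive binary matrix. Then there exists an invertible p×p matrix X over K with X ∈ Sparse(R) such that Struct(X⁻¹) = R^{p-1} exactly (Boolean power), i.e. (X⁻¹)_{jk} ≠ 0 if and only if (R^{p-1})_{jk} = 1. (Lemma A1, part 2.) -/

import Mathlib

/-- Boolean (logical) matrix product. -/
def bmul {m p q : ℕ} (A : Matrix (Fin m) (Fin p) Bool) (B : Matrix (Fin p) (Fin q) Bool) :
    Matrix (Fin m) (Fin q) Bool :=
  fun i k => decide (∃ j, A i j = true ∧ B j k = true)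

/-- Identity binary matrix. -/
def bId (p : ℕ) : Matrix (Fin p) (Fin p) Bool := fun i j => decide (i = j)

/-- Boolean (entrywise OR) sum of binary matrices. -/
def badd {m p : ℕ} (A B : Matrix (Fin m) (Fin p) Bool) : Matrix (Fin m) (Fin p) Bool :=
  fun i j => A i j || B i j

/-- k-fold Boolean power (bpow R 0 = identity). -/
def bpow {p : ℕ} (R : Matrix (Fin p) (Fin p) Bool) : ℕ → Matrix (Fin p) (Fin p) Bool
  | 0 => bId p
  | k + 1 => bmul (bpow R k) R

/-- Entrywise order on binary matrices. -/
def bLE {m p : ℕ} (A B : Matrix (Fin m) (Fin p) Bool) : Prop :=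
  ∀ i j, A i j = true → B i j = true

/-- A square binary matrix is reflexive if all diagonal entries are 1. -/
def BRefl {p : ℕ} (R : Matrix (Fin p) (Fin p) Bool) : Prop := ∀ i, R i i = true

/-- Y ∈ Sparse(T): Y vanishes wherever the pattern T is zero. -/
def Sparse {K : Type*} [Field K] {m p : ℕ} (T : Matrix (Fin m) (Fin p) Bool)
    (Y : Matrix (Fin m) (Fin p) K) : Prop :=
  ∀ i j, T i j = false → Y i j = 0

theorem bpow_mono_of_refl {p : ℕ} {R : Matrix (Fin p) (Fin p) Bool} (hR : BRefl R)
    {m n : ℕ} (hmn : m ≤ n) : bLE (bpow R m) (bpow R n) := by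
  intro i j h
  induction n, hmn using Nat.le_induction with
  | base => exact h
  | succ n _ ih =>
    simp only [bpow, bmul, decide_eq_true_eq]
    exact ⟨j, ih, hR j⟩

theorem Sparse.pow {K : Type*} [Field K] {p : ℕ} {R : Matrix (Fin p) (Fin p) Bool}
    {X : Matrix (Fin p) (Fin p) K} (hX : Sparse R X) (n : ℕ) : Sparse (bpow R n) (X ^ n) := by
  induction n with
  | zero =>
    intro i j h
    simp only [bpow, bId, decide_eq_false_iff_not] at h
    simp [h]
  | succ n ih =>
    intro i k h
    simp only [bpow, bmul, decide_eq_false_iff_not, not_exists, not_and,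
      Bool.not_eq_true] at h
    rw [pow_succ, Matrix.mul_apply]
    refine Finset.sum_eq_zero fun j _ => ?_
    cases hj : bpow R n i j
    · rw [ih i j hj, zero_mul]
    · rw [hX j k (h j hj), mul_zero]

/-- The inverse of an invertible matrix is a combination of its powers below the dimension. -/
theorem Matrix.exists_inv_eq_sum_pow {K : Type*} [Field K] {p : ℕ}
    {X : Matrix (Fin p) (Fin p) K} (hX : IsUnit X.det) :
    ∃ a : ℕ → K, X⁻¹ = ∑ i ∈ Finset.range p, a i • X ^ i := by
  have h0 : X.charpoly.coeff 0 ≠ 0 := by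
    intro h
    rw [Matrix.det_eq_sign_charpoly_coeff, h, mul_zero] at hX
    exact not_isUnit_zero hX
  set d := X.charpoly.coeff 0 with hd
  set Q := ∑ i ∈ Finset.range p, X.charpoly.coeff (i + 1) • X ^ i with hQ
  have hCH : X * Q + d • (1 : Matrix (Fin p) (Fin p) K) = 0 := by
    have h := Matrix.aeval_self_charpoly X
    rw [Polynomial.aeval_eq_sum_range, Matrix.charpoly_natDegree_eq_dim, Fintype.card_fin,
      Finset.sum_range_succ', pow_zero] at h
    rw [hQ, Finset.mul_sum, ← h]
    simp only [Matrix.mul_smul, pow_succ', hd]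
  refine ⟨fun i => -d⁻¹ * X.charpoly.coeff (i + 1), Matrix.inv_eq_right_inv ?_⟩
  simp only [mul_smul, ← Finset.smul_sum]
  rw [← hQ, Matrix.mul_smul, eq_neg_of_add_eq_zero_left hCH, smul_neg, neg_smul, neg_neg,
    smul_smul, inv_mul_cancel₀ h0, one_smul]

theorem Sparse.inv {K : Type*} [Field K] {p : ℕ} {R : Matrix (Fin p) (Fin p) Bool}
    (hR : BRefl R) {X : Matrix (Fin p) (Fin p) K} (hX : Sparse R X) (hdet : IsUnit X.det) :
    Sparse (bpow R (p - 1)) X⁻¹ := by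
  intro j k h
  obtain ⟨a, ha⟩ := Matrix.exists_inv_eq_sum_pow hdet
  rw [ha, Matrix.sum_apply]
  refine Finset.sum_eq_zero fun i hi => ?_
  have hi' : i ≤ p - 1 := Nat.le_sub_one_of_lt (Finset.mem_range.1 hi)
  have hf : bpow R i j k = false := by
    rw [← Bool.not_eq_true]
    intro ht
    simp [bpow_mono_of_refl hR hi' j k ht] at h
  rw [Matrix.smul_apply, hX.pow i j k hf, smul_zero]

theorem exists_ne_zero_forall_add_mul_ne_zero {K ι : Type*} [Field K] [Infinite K] [Finite ι]
    (u v : ι → K) : ∃ c : K, c ≠ 0 ∧ ∀ i, u i ≠ 0 → u i + c * v i ≠ 0 := by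
  have hfin : (insert 0 (Set.range fun i => -u i / v i)).Finite :=
    (Set.finite_range _).insert _
  obtain ⟨c, hc⟩ := hfin.exists_notMem
  rw [Set.mem_insert_iff, not_or] at hc
  refine ⟨c, hc.1, fun i hu h => hc.2 ⟨i, ?_⟩⟩
  have hv : v i ≠ 0 := by
    rintro hv
    simp [hv, hu] at h
  rw [div_eq_iff hv]
  linear_combination -h

/-- Rank-one update of a matrix in a single entry. -/
theorem Matrix.add_single_mul_inv_update {K : Type*} [Field K] {p : ℕ}
    {X B : Matrix (Fin p) (Fin p) K} (hXB : X * B = 1) (k l : Fin p) {c : K}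
    (hc : 1 + c * B l k ≠ 0) :
    (X + Matrix.single k l c) *
      Matrix.of (fun a b => B a b - c / (1 + c * B l k) * (B a k * B l b)) = 1 := by
  have hent (a b : Fin p) : ∑ x, X a x * B x b = (1 : Matrix (Fin p) (Fin p) K) a b := by
    rw [← Matrix.mul_apply, hXB]
  ext a b
  rw [add_mul, Matrix.add_apply, Matrix.mul_apply]
  simp only [Matrix.of_apply, mul_sub, Finset.sum_sub_distrib, hent]
  have hsum : ∑ x, X a x * (c / (1 + c * B l k) * (B x k * B l b)) =
      c / (1 + c * B l k) * B l b * (1 : Matrix (Fin p) (Fin p) K) a k := by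
    rw [← hent, Finset.mul_sum]
    exact Finset.sum_congr rfl fun x _ => by ring
  rw [hsum]
  by_cases hak : a = k
  · subst hak
    rw [Matrix.single_mul_apply_same, Matrix.of_apply, Matrix.one_apply_eq]
    field_simp
    ring
  · rw [Matrix.single_mul_apply_of_ne _ _ _ _ _ hak, Matrix.one_apply_ne hak]
    ring

/-- A generic update in an allowed entry keeps the support of the inverse and adds a new entry. -/
theorem Sparse.exists_inv_support_insert {K : Type*} [Field K] [Infinite K] {p : ℕ}
    {R : Matrix (Fin p) (Fin p) Bool} {X : Matrix (Fin p) (Fin p) K} (hX : Sparse R X)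
    (hdet : IsUnit X.det) {j k l : Fin p} (hkl : R k l = true) (hjk : X⁻¹ j k ≠ 0)
    (hll : X⁻¹ l l ≠ 0) (hjl : X⁻¹ j l = 0) :
    ∃ Y : Matrix (Fin p) (Fin p) K, IsUnit Y.det ∧ Sparse R Y ∧
      (∀ a b, X⁻¹ a b ≠ 0 → Y⁻¹ a b ≠ 0) ∧ Y⁻¹ j l ≠ 0 := by
  set B := X⁻¹ with hB
  have hXB : X * B = 1 := Matrix.mul_nonsing_inv X hdet
  obtain ⟨c, hc0, hc⟩ := exists_ne_zero_forall_add_mul_ne_zero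
    (fun i : Option (Fin p × Fin p) => i.elim 1 fun x => B x.1 x.2)
    (fun i => i.elim (B l k) fun x => B l k * B x.1 x.2 - B x.1 k * B l x.2)
  have hc1 : 1 + c * B l k ≠ 0 := hc none one_ne_zero
  have hmul := Matrix.add_single_mul_inv_update hXB k l hc1
  have hinv := Matrix.inv_eq_right_inv hmul
  refine ⟨X + Matrix.single k l c, Matrix.isUnit_det_of_right_inverse hmul, ?_, ?_, ?_⟩
  · intro a b hab
    have hne : ¬(k = a ∧ l = b) := by
      rintro ⟨rfl, rfl⟩
      simp [hkl] at hab
    rw [Matrix.add_apply, hX a b hab, Matrix.single_apply_of_ne _ _ _ _ _ hne, add_zero]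
  · intro a b hab h
    rw [hinv, Matrix.of_apply] at h
    refine hc (some (a, b)) hab ?_
    field_simp at h
    simp only [Option.elim_some]
    linear_combination h
  · rw [hinv, Matrix.of_apply, hjl, zero_sub, neg_ne_zero]
    exact mul_ne_zero (div_ne_zero hc0 hc1) (mul_ne_zero hjk hll)

/-- Lemma A1, part 2. -/
theorem exists_inv_struct_eq_bpow {K : Type*} [Field K] [Infinite K] {p : ℕ} (hp : 0 < p)
    (R : Matrix (Fin p) (Fin p) Bool) (hR : BRefl R) :
    ∃ X : Matrix (Fin p) (Fin p) K, IsUnit X.det ∧ Sparse R X ∧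
      ∀ j k, X⁻¹ j k ≠ 0 ↔ bpow R (p - 1) j k = true := by
  let supp (X : Matrix (Fin p) (Fin p) K) : Set (Fin p × Fin p) := {x | X⁻¹ x.1 x.2 ≠ 0}
  let S : Set (Matrix (Fin p) (Fin p) K) :=
    {X | IsUnit X.det ∧ Sparse R X ∧ ∀ i, X⁻¹ i i ≠ 0}
  have hne : (supp '' S).Nonempty := by
    refine ⟨_, 1, ⟨by simp, fun i j h => Matrix.one_apply_ne ?_, by simp⟩, rfl⟩
    rintro rfl
    simp [hR i] at h
  obtain ⟨_, ⟨⟨X, ⟨hdet, hX, hdiag⟩, rfl⟩, hmax⟩⟩ :=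
    (Set.toFinite (supp '' S)).exists_maximal hne
  refine ⟨X, hdet, hX, fun j k => ⟨fun h => ?_, fun h => ?_⟩⟩
  · by_contra hf
    exact h (hX.inv hR hdet j k (by simpa using hf))
  · have key (n : ℕ) : ∀ l, bpow R n j l = true → X⁻¹ j l ≠ 0 := by
      induction n with
      | zero =>
        intro l hl
        simp only [bpow, bId, decide_eq_true_eq] at hl
        exact hl ▸ hdiag j
      | succ n ih =>
        intro l hl hjl
        simp only [bpow, bmul, decide_eq_true_eq] at hl
        obtain ⟨m, hjm, hml⟩ := hl
        obtain ⟨Y, hYdet, hY, hsub, hYjl⟩ :=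
          hX.exists_inv_support_insert hdet hml (ih m hjm) (hdiag l) hjl
        have hle : supp Y ≤ supp X :=
          hmax ⟨Y, ⟨hYdet, hY, fun i => hsub i i (hdiag i)⟩, rfl⟩ fun x hx => hsub _ _ hx
        exact (hle (show (j, l) ∈ supp Y from hYjl)) hjl
    exact key (p - 1) k h
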